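/- Suppose H is a [3]-graph on n ≥ 69 vertices such that every pair of non-adjacent vertices u, v satisfies d_{∂H}(u) + d_{∂H}(v) ≥ n + 65, and H contains no Hamiltonian Berge cycle. Let C = v_1, e_1, ..., v_ℓ, e_ℓ, v_1 be a longest Berge cycle in H with ℓ ∈ {n−1, n−2}, let u ∈ V(H) − V(C), let U_u ⊆ V(C) be a usable set for u with |U_u| ≥ d_C(u)/6, and let X = {v_{i+1} : v_i ∈ U_u ∩ B_1(C)}, where B_1(C) = {v : (n+65)/2 − 3 ≤ d_C(v) < 3n/4 + 13}. Then |X ∩ S'(C)| ≤ 1, where S'(C) = {v : d_C(v) < n/4 + 18}. -/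

import Mathlib

/-- Two vertices are adjacent in the hypergraph with edge set `H`
if some edge contains both of them. -/
def HAdj {V : Type*} (H : Finset (Finset V)) (u v : V) : Prop :=
  u ≠ v ∧ ∃ e ∈ H, u ∈ e ∧ v ∈ e

/-- The degree of `u` in the 2-shadow `∂H`: the number of vertices adjacent to `u`. -/
noncomputable def shadowDeg {V : Type*} (H : Finset (Finset V)) (u : V) : ℕ :=
  {v | HAdj H u v}.ncard

/-- A `[3]`-graph: every edge has exactly 2 or 3 vertices. -/
def IsThreeGraph {V : Type*} (H : Finset (Finset V)) : Prop :=
  ∀ e ∈ H, e.card = 2 ∨ e.card = 3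

/-- A Berge cycle of length `t` in the hypergraph with edge set `H`:
`t` distinct vertices `vtx i` and `t` distinct edges `edge i` (indices mod `t`)
with `{vtx i, vtx (i+1)} ⊆ edge i` for every `i`. -/
structure BergeCycle {V : Type*} (H : Finset (Finset V)) (t : ℕ) where
  vtx : ZMod t → V
  edge : ZMod t → Finset V
  vtx_inj : Function.Injective vtx
  edge_inj : Function.Injective edge
  edge_mem : ∀ i, edge i ∈ H
  mem_fst : ∀ i, vtx i ∈ edge i
  mem_snd : ∀ i, vtx (i + 1) ∈ edge i

/-- `d_C(u)`: the number of vertices of the Berge cycle `C` adjacent to `u`. -/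
noncomputable def BergeCycle.dC {V : Type*} {H : Finset (Finset V)} {t : ℕ}
    (C : BergeCycle H t) (u : V) : ℕ :=
  {v | v ∈ Set.range C.vtx ∧ HAdj H u v}.ncard

/-- `H` contains a Hamiltonian Berge cycle, i.e. a Berge cycle whose
vertex set is all of `V`. -/
def HamiltonianBergeCycle {V : Type*} (H : Finset (Finset V)) : Prop :=
  ∃ (t : ℕ) (C : BergeCycle H t), Set.range C.vtx = Set.univ

/-- A set `U` of indices of vertices of the Berge cycle `C` is usable for `u`:
(1) for every `i ∈ U` there is an edge in `E(u, v_{i-1}) - {e_{i-2}}`;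
(2) any two distinct `i, j ∈ U` are non-consecutive on `C`;
(3) for every pair of distinct `i, j ∈ U` there are distinct edges
`e ∈ E(u, v_{i-1}) - {e_{i-2}}` and `e' ∈ E(u, v_{j-1}) - {e_{j-2}}`. -/
def Usable {V : Type*} {H : Finset (Finset V)} {t : ℕ} (C : BergeCycle H t) (u : V)
    (U : Set (ZMod t)) : Prop :=
  (∀ i ∈ U, ∃ e ∈ H, e ≠ C.edge (i - 2) ∧ u ∈ e ∧ C.vtx (i - 1) ∈ e) ∧
  (∀ i ∈ U, ∀ j ∈ U, i ≠ j → j ≠ i + 1 ∧ j ≠ i - 1) ∧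
  (∀ i ∈ U, ∀ j ∈ U, i ≠ j → ∃ e ∈ H, ∃ e' ∈ H, e ≠ e' ∧
    e ≠ C.edge (i - 2) ∧ u ∈ e ∧ C.vtx (i - 1) ∈ e ∧
    e' ≠ C.edge (j - 2) ∧ u ∈ e' ∧ C.vtx (j - 1) ∈ e')

/-- `CwBtw a b c` : on the cycle oriented clockwise, `b` lies strictly between
`a` and `c` on the clockwise arc from `a` to `c`. -/
def CwBtw {t : ℕ} (a b c : ZMod t) : Prop :=
  0 < (b - a).val ∧ (b - a).val < (c - a).val

/-- `e` is an `(i,j;k)`-bridge of the Berge cycle `C`. -/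
def IsBridge {V : Type*} [DecidableEq V] {H : Finset (Finset V)} {t : ℕ}
    (C : BergeCycle H t) (i j k : ZMod t) (e : Finset V) : Prop :=
  (CwBtw i k j ∧ ((e = C.edge (k + 1) ∧ e = {C.vtx i, C.vtx (k + 1), C.vtx (k + 2)}) ∨
                (e = C.edge (k - 1) ∧ e = {C.vtx j, C.vtx k, C.vtx (k - 1)}))) ∨
  (CwBtw j k i ∧ ((e = C.edge (k - 1) ∧ e = {C.vtx i, C.vtx k, C.vtx (k - 1)}) ∨
                (e = C.edge (k + 1) ∧ e = {C.vtx j, C.vtx (k + 1), C.vtx (k + 2)})))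

/-- `R(v_i, v_j)`: the set of bridges produced by the pair `{v_i, v_j}`,
i.e. all `(i,j;k)`-bridges over `k ∉ {i, j}`. -/
def RBridges {V : Type*} [DecidableEq V] {H : Finset (Finset V)} {t : ℕ}
    (C : BergeCycle H t) (i j : ZMod t) : Set (Finset V) :=
  {e | ∃ k : ZMod t, k ≠ i ∧ k ≠ j ∧ IsBridge C i j k e}


open Classical in
/-- Berge path from `a` to `b` with vertex set `S` and edge set `T`. -/
def BP {V : Type*} (H : Finset (Finset V)) (a b : V) (S : Finset V)
    (T : Finset (Finset V)) : Prop :=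
  ∃ (m : ℕ) (p : ℕ → V) (g : ℕ → Finset V), p 0 = a ∧ p m = b ∧
    (∀ x ≤ m, ∀ y ≤ m, p x = p y → x = y) ∧
    (∀ x < m, ∀ y < m, g x = g y → x = y) ∧
    (∀ k < m, g k ∈ H ∧ p k ∈ g k ∧ p (k + 1) ∈ g k) ∧
    (∀ z, z ∈ S ↔ ∃ k ≤ m, p k = z) ∧ (∀ z, z ∈ T ↔ ∃ k < m, g k = z)

open Classical in
theorem BP.seg {V : Type*} {H : Finset (Finset V)} (p : ℕ → V) (g : ℕ → Finset V)
    (x y : ℕ) (hxy : x ≤ y)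
    (hp : ∀ i ∈ Finset.Icc x y, ∀ j ∈ Finset.Icc x y, p i = p j → i = j)
    (hg : ∀ i ∈ Finset.Ico x y, ∀ j ∈ Finset.Ico x y, g i = g j → i = j)
    (hm : ∀ k ∈ Finset.Ico x y, g k ∈ H ∧ p k ∈ g k ∧ p (k + 1) ∈ g k) :
    BP H (p x) (p y) ((Finset.Icc x y).image p) ((Finset.Ico x y).image g) := by
  simp only [Finset.mem_Icc, Finset.mem_Ico] at hp hg hm
  refine ⟨y - x, fun k => p (x + k), fun k => g (x + k), by simp, by
    simp [hxy], ?_, ?_, ?_, ?_, ?_⟩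
  · intro i hi j hj h
    have := hp (x + i) (by omega) (x + j) (by omega) h
    omega
  · intro i hi j hj h
    have := hg (x + i) (by omega) (x + j) (by omega) h
    omega
  · intro k hk
    exact hm (x + k) (by omega)
  · intro z
    simp only [Finset.mem_image, Finset.mem_Icc]
    constructor
    · rintro ⟨k, hk, rfl⟩
      exact ⟨k - x, by omega, by congr 1; omega⟩
    · rintro ⟨k, hk, rfl⟩
      exact ⟨x + k, by omega, rfl⟩
  · intro z
    simp only [Finset.mem_image, Finset.mem_Ico]
    constructor
    · rintro ⟨k, hk, rfl⟩
      exact ⟨k - x, by omega, by congr 1; omega⟩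
    · rintro ⟨k, hk, rfl⟩
      exact ⟨x + k, by omega, rfl⟩

theorem BP.single {V : Type*} {H : Finset (Finset V)} (w : V) : BP H w w {w} ∅ := by
  refine ⟨0, fun _ => w, fun _ => ∅, rfl, rfl, ?_, ?_, ?_, ?_, ?_⟩ <;> simp [eq_comm]

theorem BP.rev {V : Type*} {H : Finset (Finset V)} {a b : V} {S : Finset V}
    {T : Finset (Finset V)} (h : BP H a b S T) : BP H b a S T := by
  obtain ⟨m, p, g, h0, h1, hp, hg, hm, hS, hT⟩ := h
  refine ⟨m, fun k => p (m - k), fun k => g (m - 1 - k), by simpa, by simpa, ?_, ?_, ?_, ?_, ?_⟩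
  · intro x hx y hy h
    have := hp _ (by omega) _ (by omega) h
    omega
  · intro x hx y hy h
    have := hg _ (by omega) _ (by omega) h
    omega
  · intro k hk
    have := hm (m - 1 - k) (by omega)
    refine ⟨this.1, ?_, ?_⟩
    · have e : m - k = m - 1 - k + 1 := by omega
      simp only [e]; exact this.2.2
    · have e : m - (k + 1) = m - 1 - k := by omega
      simp only [e]; exact this.2.1
  · intro z
    rw [hS]
    constructor
    · rintro ⟨k, hk, rfl⟩
      exact ⟨m - k, by omega, congrArg p (by omega)⟩
    · rintro ⟨k, hk, rfl⟩
      exact ⟨m - k, by omega, rfl⟩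
  · intro z
    rw [hT]
    constructor
    · rintro ⟨k, hk, rfl⟩
      exact ⟨m - 1 - k, by omega, congrArg g (by omega)⟩
    · rintro ⟨k, hk, rfl⟩
      exact ⟨m - 1 - k, by omega, rfl⟩

open Classical in
theorem BP.join {V : Type*} {H : Finset (Finset V)} {a b c d : V} {S S' : Finset V}
    {T T' : Finset (Finset V)} (h : BP H a b S T) (h' : BP H c d S' T')
    (hS : ∀ z ∈ S, z ∉ S') (hT : ∀ z ∈ T, z ∉ T') (e : Finset V) (he : e ∈ H)
    (heT : e ∉ T) (heT' : e ∉ T') (hb : b ∈ e) (hc : c ∈ e) :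
    BP H a d (S ∪ S') (insert e (T ∪ T')) := by
  obtain ⟨m, p, g, h0, h1, hp, hg, hm, hS1, hT1⟩ := h
  obtain ⟨m', p', g', h0', h1', hp', hg', hm', hS1', hT1'⟩ := h'
  have hpp : ∀ x ≤ m, ∀ y ≤ m', p x ≠ p' y := by
    intro x hx y hy hxy
    exact hS (p x) ((hS1 _).2 ⟨x, hx, rfl⟩) ((hS1' _).2 ⟨y, hy, hxy.symm⟩)
  have hgg : ∀ x < m, ∀ y < m', g x ≠ g' y := by
    intro x hx y hy hxy
    exact hT (g x) ((hT1 _).2 ⟨x, hx, rfl⟩) ((hT1' _).2 ⟨y, hy, hxy.symm⟩)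
  have hge : ∀ x < m, g x ≠ e := by
    intro x hx hxy
    exact heT ((hT1 _).2 ⟨x, hx, hxy⟩)
  have hge' : ∀ x < m', g' x ≠ e := by
    intro x hx hxy
    exact heT' ((hT1' _).2 ⟨x, hx, hxy⟩)
  refine ⟨m + m' + 1, fun k => if k ≤ m then p k else p' (k - m - 1),
    fun k => if k < m then g k else if k = m then e else g' (k - m - 1), by simpa, ?_, ?_, ?_, ?_,
    ?_, ?_⟩
  · have : ¬ (m + m' + 1 ≤ m) := by omega
    simp only [this, if_false]
    rw [← h1']; congr 1; omega
  · intro x hx y hy hxy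
    dsimp only at hxy
    split_ifs at hxy with h1 h2 h2
    · exact hp _ h1 _ h2 hxy
    · exact absurd hxy (hpp _ h1 _ (by omega))
    · exact absurd hxy.symm (hpp _ h2 _ (by omega))
    · have := hp' _ (by omega) _ (by omega) hxy
      omega
  · intro x hx y hy hxy
    dsimp only at hxy
    split_ifs at hxy with h1 h2 h3 h2 h3 h4 h3 h4
    · exact hg _ h1 _ h2 hxy
    · exact absurd hxy (hge _ h1)
    · exact absurd hxy (hgg _ h1 _ (by omega))
    · exact absurd hxy.symm (hge _ h3)
    · omega
    · exact absurd hxy.symm (hge' _ (by omega))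
    · exact absurd hxy.symm (hgg _ h3 _ (by omega))
    · exact absurd hxy (hge' _ (by omega))
    · have := hg' _ (by omega) _ (by omega) hxy
      omega
  · intro k hk
    dsimp only
    rcases lt_trichotomy k m with h | h | h
    · rw [if_pos h, if_pos h.le, if_pos (by omega)]
      exact hm k h
    · subst h
      rw [if_neg (lt_irrefl _), if_pos rfl, if_pos le_rfl, if_neg (by omega)]
      refine ⟨he, by rwa [h1], ?_⟩
      have : k + 1 - k - 1 = 0 := by omega
      rw [this, h0']; exact hc
    · rw [if_neg (by omega), if_neg (by omega), if_neg (by omega), if_neg (by omega)]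
      have := hm' (k - m - 1) (by omega)
      have e : k + 1 - m - 1 = k - m - 1 + 1 := by omega
      rw [e]; exact this
  · intro z
    rw [Finset.mem_union, hS1, hS1']
    constructor
    · rintro (⟨k, hk, rfl⟩ | ⟨k, hk, rfl⟩)
      · exact ⟨k, by omega, by simp [hk]⟩
      · refine ⟨m + 1 + k, by omega, ?_⟩
        dsimp only
        rw [if_neg (by omega)]; congr 1; omega
    · rintro ⟨k, hk, rfl⟩
      by_cases h : k ≤ m
      · exact Or.inl ⟨k, h, by simp [h]⟩
      · exact Or.inr ⟨k - m - 1, by omega, by simp [h]⟩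
  · intro z
    rw [Finset.mem_insert, Finset.mem_union, hT1, hT1']
    constructor
    · rintro (rfl | ⟨k, hk, rfl⟩ | ⟨k, hk, rfl⟩)
      · exact ⟨m, by omega, by simp⟩
      · exact ⟨k, by omega, by simp [hk]⟩
      · refine ⟨m + 1 + k, by omega, ?_⟩
        dsimp only
        rw [if_neg (by omega), if_neg (by omega)]; congr 1; omega
    · rintro ⟨k, hk, rfl⟩
      rcases lt_trichotomy k m with h | h | h
      · exact Or.inr (Or.inl ⟨k, h, by simp [h]⟩)
      · exact Or.inl (by simp [h])
      · refine Or.inr (Or.inr ⟨k - m - 1, by omega, ?_⟩)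
        dsimp only
        rw [if_neg (by omega), if_neg (by omega)]

theorem BP.close {V : Type*} {H : Finset (Finset V)} {a b : V} {S : Finset V}
    {T : Finset (Finset V)} (h : BP H a b S T) (e : Finset V) (he : e ∈ H)
    (heT : e ∉ T) (ha : a ∈ e) (hb : b ∈ e) :
    ∃ C : BergeCycle H S.card, ∀ z, z ∈ Set.range C.vtx ↔ z ∈ S := by
  classical
  obtain ⟨m, p, g, h0, h1, hp, hg, hm, hS1, hT1⟩ := h
  have hc : S.card = m + 1 := by
    have : S = (Finset.range (m + 1)).image p := by
      ext z; rw [hS1]; simp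
    rw [this, Finset.card_image_of_injOn, Finset.card_range]
    intro x hx y hy hxy
    simp at hx hy
    exact hp x (by omega) y (by omega) hxy
  rw [hc]
  have hge : ∀ x < m, g x ≠ e := by
    intro x hx hxy
    exact heT ((hT1 _).2 ⟨x, hx, hxy⟩)
  have hlt : ∀ i : ZMod (m + 1), i.val < m + 1 := fun i => ZMod.val_lt i
  refine ⟨⟨fun i => p i.val, fun i => if i.val < m then g i.val else e, ?_, ?_, ?_, ?_, ?_⟩, ?_⟩
  · intro i j hij
    have := hlt i
    have := hlt j
    exact ZMod.val_injective _ (hp _ (by omega) _ (by omega) hij)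
  · intro i j hij
    have := hlt i
    have := hlt j
    apply ZMod.val_injective
    dsimp only at hij
    split_ifs at hij with h1 h2 h2
    · exact hg _ h1 _ h2 hij
    · exact absurd hij (hge _ h1)
    · exact absurd hij.symm (hge _ h2)
    · omega
  · intro i
    split_ifs with h
    · exact (hm _ h).1
    · exact he
  · intro i
    have := hlt i
    split_ifs with h
    · exact (hm _ h).2.1
    · have : i.val = m := by omega
      rw [this, h1]; exact hb
  · intro i
    have := hlt i
    split_ifs with h
    · have e1 : i + 1 = ((i.val + 1 : ℕ) : ZMod (m + 1)) := by
        push_cast; rw [ZMod.natCast_zmod_val]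
      rw [e1, ZMod.val_cast_of_lt (by omega)]
      exact (hm _ h).2.2
    · have h2 : i.val = m := by omega
      have : i + 1 = 0 := by
        rw [← ZMod.natCast_zmod_val i, h2]
        have := ZMod.natCast_self (m + 1)
        push_cast at this ⊢
        exact this
      rw [this, ZMod.val_zero, h0]; exact ha
  · intro z
    rw [hS1]
    constructor
    · rintro ⟨i, rfl⟩
      have := hlt i
      exact ⟨i.val, by omega, rfl⟩
    · rintro ⟨k, hk, rfl⟩
      refine ⟨(k : ZMod (m + 1)), ?_⟩
      dsimp only
      rw [ZMod.val_cast_of_lt (by omega)]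

theorem card4 {V : Type*} {H : Finset (Finset V)} (h3 : IsThreeGraph H) {e : Finset V}
    (he : e ∈ H) {a b c d : V} (ha : a ∈ e) (hb : b ∈ e) (hc : c ∈ e) (hd : d ∈ e) :
    a = b ∨ a = c ∨ a = d ∨ b = c ∨ b = d ∨ c = d := by
  classical
  by_contra hcon
  push Not at hcon
  obtain ⟨h1, h2, h3', h4, h5, h6⟩ := hcon
  have hsub : ({a, b, c, d} : Finset V) ⊆ e := by
    intro z hz
    simp only [Finset.mem_insert, Finset.mem_singleton] at hz
    rcases hz with rfl | rfl | rfl | rfl <;> assumption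
  have := Finset.card_le_card hsub
  have h4' : ({a, b, c, d} : Finset V).card = 4 := by
    simp [*]
  have := h3 e he
  omega


theorem cast_pred {t : ℕ} (c : ℕ) (hc : c ≤ t) : ((t - c : ℕ) : ZMod t) = -(c : ZMod t) := by
  rw [Nat.cast_sub hc, ZMod.natCast_self, zero_sub]

theorem zmod_win {t : ℕ} (s : ZMod t)
    (k l : ℕ) (hk : k < t) (hl : l < t) (h : s + (k : ZMod t) = s + (l : ZMod t)) : k = l := by
  have h1 := add_left_cancel h
  have h2 := congrArg ZMod.val h1
  rwa [ZMod.val_cast_of_lt hk, ZMod.val_cast_of_lt hl] at h2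

theorem cyc_path {V : Type*} {H : Finset (Finset V)} (h3 : IsThreeGraph H) {t : ℕ} (ht : 3 ≤ t)
    (C : BergeCycle H t) (w : V) (hw : w ∉ Set.range C.vtx) (s : ZMod t) (b lo : ℕ)
    (hb : lo + 1 ≤ b) (hbt : b < t) (e e' : Finset V) (he : e ∈ H) (he' : e' ∈ H)
    (hee : e ≠ e') (hwe : w ∈ e) (hwe' : w ∈ e') (h1 : C.vtx (s - 1) ∈ e)
    (h1' : C.vtx (s + b - 1) ∈ e') (h2 : e ≠ C.edge (s - 2)) (h2' : e' ≠ C.edge (s + b - 2)) :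
    ∃ (S : Finset V) (T : Finset (Finset V)),
      BP H (C.vtx (s + (lo : ℕ))) (C.vtx (s + (b : ℕ))) S T ∧
      S.card = t + 1 - lo ∧ (∀ k < lo, C.vtx (s + (k : ℕ)) ∉ S) ∧
      ∀ f ∈ T, f = e ∨ f = e' ∨
        ∃ k : ℕ, (lo ≤ k ∧ k + 1 < b ∨ b ≤ k ∧ k + 1 < t) ∧ f = C.edge (s + (k : ℕ)) := by
  classical
  set p : ℕ → V := fun k => C.vtx (s + (k : ℕ)) with hp
  set g : ℕ → Finset V := fun k => C.edge (s + (k : ℕ)) with hg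
  have pinj : ∀ k l, k < t → l < t → p k = p l → k = l := fun k l hk hl h =>
    zmod_win s k l hk hl (C.vtx_inj h)
  have ginj : ∀ k l, k < t → l < t → g k = g l → k = l := fun k l hk hl h =>
    zmod_win s k l hk hl (C.edge_inj h)
  have gm : ∀ k, g k ∈ H ∧ p k ∈ g k ∧ p (k + 1) ∈ g k := by
    intro k
    refine ⟨C.edge_mem _, C.mem_fst _, ?_⟩
    have := C.mem_snd (s + k)
    simp only [hp, hg]
    push_cast
    rwa [← add_assoc]
  have hwp : ∀ k, w ≠ p k := fun k h => hw ⟨_, h.symm⟩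
  have c1 : p (t - 1) = C.vtx (s - 1) := by
    simp only [hp]; rw [cast_pred 1 (by omega)]; simp [sub_eq_add_neg]
  have c2 : g (t - 2) = C.edge (s - 2) := by
    simp only [hg]; rw [cast_pred 2 (by omega)]; simp [sub_eq_add_neg]
  have c3 : p (b - 1) = C.vtx (s + b - 1) := by
    simp only [hp]; rw [Nat.cast_sub (by omega)]; simp [add_sub_assoc]
  have key : ∀ (f : Finset V) (c k : ℕ), w ∈ f → p c ∈ f → c < t → k + 1 < t → f = g k →
      c = k ∨ c = k + 1 := by
    intro f c k hwf hcf hc hk hf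
    subst hf
    have hgk := gm k
    rcases card4 h3 hgk.1 hwf hcf hgk.2.1 hgk.2.2 with h | h | h | h | h | h
    · exact absurd h (hwp _)
    · exact absurd h (hwp _)
    · exact absurd h (hwp _)
    · exact Or.inl (pinj _ _ hc (by omega) h)
    · exact Or.inr (pinj _ _ hc (by omega) h)
    · have := pinj _ _ (by omega) (by omega) h
      omega
  have keye : ∀ k, k + 1 < t → e ≠ g k := by
    intro k hk h
    rw [← c1] at h1
    have := key e (t - 1) k hwe h1 (by omega) hk h
    have : k = t - 2 := by omega
    rw [this, c2] at h
    exact h2 h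
  have keye' : ∀ k, k + 1 < t → k + 1 ≠ b → e' ≠ g k := by
    intro k hk hkb h
    rw [← c3] at h1'
    have := key e' (b - 1) k hwe' h1' (by omega) hk h
    have hk2 : k + 2 = b := by omega
    apply h2'
    rw [h]
    simp only [hg]
    rw [← hk2]
    push_cast
    congr 1
    ring
  have P1 := BP.seg (H := H) p g lo (b - 1) (by omega)
    (by simp only [Finset.mem_Icc]; intro i hi j hj; exact pinj _ _ (by omega) (by omega))
    (by simp only [Finset.mem_Ico]; intro i hi j hj; exact ginj _ _ (by omega) (by omega))
    (fun k _ => gm k)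
  have P3 := (BP.seg (H := H) p g b (t - 1) (by omega)
    (by simp only [Finset.mem_Icc]; intro i hi j hj; exact pinj _ _ (by omega) (by omega))
    (by simp only [Finset.mem_Ico]; intro i hi j hj; exact ginj _ _ (by omega) (by omega))
    (fun k _ => gm k)).rev
  have P2 := BP.single (H := H) w
  have P12 := P1.join P2 (by
      simp only [Finset.mem_image, Finset.mem_singleton]
      rintro z ⟨k, hk, rfl⟩ h
      exact hwp k h.symm) (by simp) e' he' (by
      simp only [Finset.mem_image, Finset.mem_Ico]
      rintro ⟨k, hk, h⟩
      exact keye' k (by omega) (by omega) h.symm) (by simp) (by rw [c3]; exact h1') hwe'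
  have P := P12.join P3 (by
      simp only [Finset.mem_union, Finset.mem_image, Finset.mem_singleton, Finset.mem_Icc]
      rintro z (⟨k, hk, rfl⟩ | rfl) ⟨l, hl, h⟩
      · have := pinj _ _ (by omega) (by omega) h
        omega
      · exact hwp l h.symm) (by
      simp only [Finset.mem_insert, Finset.mem_union, Finset.mem_image, Finset.mem_Ico]
      rintro z (rfl | ⟨k, hk, rfl⟩ | h0) ⟨l, hl, h⟩
      · exact keye' l (by omega) (by omega) h.symm
      · have := ginj _ _ (by omega) (by omega) h
        omega
      · simp at h0) e he (by
      simp only [Finset.mem_insert, Finset.mem_union, Finset.mem_image, Finset.mem_Ico]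
      rintro (h | ⟨k, hk, h⟩ | h)
      · exact hee h
      · exact keye k (by omega) h.symm
      · simp at h) (by
      simp only [Finset.mem_image, Finset.mem_Ico]
      rintro ⟨k, hk, h⟩
      exact keye k (by omega) h.symm) hwe (by rw [c1]; exact h1)
  refine ⟨_, _, P, ?_, ?_, ?_⟩
  · have : (Finset.image p (Finset.Icc lo (b - 1)) ∪ {w} ∪ Finset.image p (Finset.Icc b (t - 1)))
        = insert w ((Finset.Ico lo t).image p) := by
      ext z
      simp only [Finset.mem_union, Finset.mem_image, Finset.mem_singleton, Finset.mem_Icc,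
        Finset.mem_insert, Finset.mem_Ico]
      constructor
      · rintro ((⟨k, hk, rfl⟩ | rfl) | ⟨k, hk, rfl⟩)
        · exact Or.inr ⟨k, by omega, rfl⟩
        · exact Or.inl rfl
        · exact Or.inr ⟨k, by omega, rfl⟩
      · rintro (rfl | ⟨k, hk, rfl⟩)
        · exact Or.inl (Or.inr rfl)
        · by_cases h : k < b
          · exact Or.inl (Or.inl ⟨k, by omega, rfl⟩)
          · exact Or.inr ⟨k, by omega, rfl⟩
    rw [this, Finset.card_insert_of_notMem, Finset.card_image_of_injOn, Nat.card_Ico]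
    · omega
    · intro x hx y hy hxy
      simp only [Finset.coe_Ico, Set.mem_Ico] at hx hy
      exact pinj _ _ (by omega) (by omega) hxy
    · simp only [Finset.mem_image, not_exists, not_and]
      intro k _ h
      exact hwp k h.symm
  · intro k hk hmem
    simp only [Finset.mem_union, Finset.mem_image, Finset.mem_singleton, Finset.mem_Icc] at hmem
    rcases hmem with (⟨l, hl, h⟩ | h) | ⟨l, hl, h⟩
    · have := pinj _ _ (by omega) (by omega) h
      omega
    · exact hwp k h.symm
    · have := pinj _ _ (by omega) (by omega) h
      omega
  · intro f hf
    simp only [Finset.mem_insert, Finset.mem_union, Finset.mem_image, Finset.mem_Ico] at hf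
    rcases hf with h | (h | ⟨k, hk, h⟩ | h) | ⟨k, hk, h⟩
    · exact Or.inl h
    · exact Or.inr (Or.inl h)
    · exact Or.inr (Or.inr ⟨k, by omega, h.symm⟩)
    · simp at h
    · exact Or.inr (Or.inr ⟨k, by omega, h.symm⟩)

open Classical in
theorem deg_le {V : Type*} [Fintype V] (H : Finset (Finset V)) (S : Finset V) (z : V) :
    shadowDeg H z + S.card ≤ (S.filter (fun v => HAdj H z v)).card + Fintype.card V := by
  have h1 : {v | HAdj H z v} = ((Finset.univ.filter (fun v => HAdj H z v) : Finset V) : Set V) := by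
    ext; simp
  unfold shadowDeg
  rw [h1, Set.ncard_coe_finset]
  have h2 : (Finset.univ.filter (fun v => HAdj H z v)) ⊆
      S.filter (fun v => HAdj H z v) ∪ Sᶜ := by
    intro v hv
    simp at hv ⊢
    tauto
  have h3 := (Finset.card_le_card h2).trans (Finset.card_union_le _ _)
  rw [Finset.card_compl] at h3
  have := Finset.card_le_univ S
  omega

theorem HAdj.symm' {V : Type*} {H : Finset (Finset V)} {u v : V} (h : HAdj H u v) :
    HAdj H v u := by
  obtain ⟨h1, e, he, h2, h3⟩ := h
  exact ⟨h1.symm, e, he, h3, h2⟩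

open Classical in
theorem path_count {V : Type*} [Fintype V] {H : Finset (Finset V)} (h3 : IsThreeGraph H) {t : ℕ}
    (hno : ∀ _ : BergeCycle H (t + 1), False) (hn : Fintype.card V ≤ t + 2)
    {a b : V} {S : Finset V} {T : Finset (Finset V)}
    (h : BP H a b S T) (hS : S.card = t + 1) (ht : 2 ≤ t) :
    shadowDeg H a + shadowDeg H b ≤ t + 10 + (T.filter (fun e => a ∈ e)).card +
      (T.filter (fun e => b ∈ e)).card := by
  obtain ⟨m, p, g, h0, h1, hp, hg, hm, hS1, hT1⟩ := h
  have hSi : S = (Finset.range (m + 1)).image p := by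
    ext z; rw [hS1]; simp
  have hmt : m = t := by
    have : S.card = m + 1 := by
      rw [hSi, Finset.card_image_of_injOn, Finset.card_range]
      intro x hx y hy hxy
      simp at hx hy
      exact hp x (by omega) y (by omega) hxy
    omega
  subst hmt
  have claim : ∀ k < m, HAdj H a (p (k + 1)) → HAdj H b (p k) →
      k = 0 ∨ k = m - 1 ∨ (k + 1 < m ∧ a ∈ g (k + 1)) ∨ (1 ≤ k ∧ b ∈ g (k - 1)) ∨
      p (k + 1) ∈ g 0 ∨ p k ∈ g (m - 1) := by
    intro k hk ⟨_, α, hαH, hα1, hα2⟩ ⟨_, β, hβH, hβ1, hβ2⟩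
    by_contra hcon
    push Not at hcon
    obtain ⟨n1, n2, n3, n4, n5, n6⟩ := hcon
    subst h0
    subst h1
    have hαg : ∀ l < m, l ≠ k → α ≠ g l := by
      rintro l hl hlk rfl
      obtain ⟨q1, q2, q3⟩ := hm l hl
      rcases card4 h3 q1 hα1 hα2 q2 q3 with h | h | h | h | h | h
      · have := hp _ (by omega) _ (by omega) h; omega
      · have := hp _ (by omega) _ (by omega) h
        subst this; exact n5 hα2
      · have := hp _ (by omega) _ (by omega) h; omega
      · have := hp _ (by omega) _ (by omega) h
        subst this; exact n3 hl hα1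
      · have := hp _ (by omega) _ (by omega) h; omega
      · have := hp _ (by omega) _ (by omega) h; omega
    have hβg : ∀ l < m, l ≠ k → β ≠ g l := by
      rintro l hl hlk rfl
      obtain ⟨q1, q2, q3⟩ := hm l hl
      rcases card4 h3 q1 hβ1 hβ2 q2 q3 with h | h | h | h | h | h
      · have := hp _ (by omega) _ (by omega) h; omega
      · have := hp _ (by omega) _ (by omega) h; omega
      · have := hp _ (by omega) _ (by omega) h
        have : l = m - 1 := by omega
        subst this; exact n6 hβ2
      · have := hp _ (by omega) _ (by omega) h; omega
      · have := hp _ (by omega) _ (by omega) h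
        have : l = k - 1 := by omega
        subst this; exact n4 (by omega) hβ1
      · have := hp _ (by omega) _ (by omega) h; omega
    have hαβ : α ≠ β := by
      rintro rfl
      rcases card4 h3 hαH hα1 hα2 hβ1 hβ2 with h | h | h | h | h | h
      all_goals (have := hp _ (by omega) _ (by omega) h; omega)
    have P1 := BP.seg (H := H) p g 0 k (by omega)
      (by simp only [Finset.mem_Icc]; intro i hi j hj; exact hp _ (by omega) _ (by omega))
      (by simp only [Finset.mem_Ico]; intro i hi j hj; exact hg _ (by omega) _ (by omega))
      (by simp only [Finset.mem_Ico]; intro i hi; exact hm _ (by omega))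
    have P2 := (BP.seg (H := H) p g (k + 1) m (by omega)
      (by simp only [Finset.mem_Icc]; intro i hi j hj; exact hp _ (by omega) _ (by omega))
      (by simp only [Finset.mem_Ico]; intro i hi j hj; exact hg _ (by omega) _ (by omega))
      (by simp only [Finset.mem_Ico]; intro i hi; exact hm _ (by omega))).rev
    have P := P1.join P2 (by
        simp only [Finset.mem_image, Finset.mem_Icc]
        rintro z ⟨i, hi, rfl⟩ ⟨l, hl, h⟩
        have := hp _ (by omega) _ (by omega) h
        omega) (by
        simp only [Finset.mem_image, Finset.mem_Ico]
        rintro z ⟨i, hi, rfl⟩ ⟨l, hl, h⟩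
        have := hg _ (by omega) _ (by omega) h
        omega) β hβH (by
        simp only [Finset.mem_image, Finset.mem_Ico]
        rintro ⟨i, hi, h⟩
        exact hβg i (by omega) (by omega) h.symm) (by
        simp only [Finset.mem_image, Finset.mem_Ico]
        rintro ⟨i, hi, h⟩
        exact hβg i (by omega) (by omega) h.symm) hβ2 hβ1
    obtain ⟨D, -⟩ := P.close α hαH (by
        simp only [Finset.mem_insert, Finset.mem_union, Finset.mem_image, Finset.mem_Ico]
        rintro (h | ⟨i, hi, h⟩ | ⟨i, hi, h⟩)
        · exact hαβ h
        · exact hαg i (by omega) (by omega) h.symm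
        · exact hαg i (by omega) (by omega) h.symm) hα1 hα2
    have hSS : Finset.image p (Finset.Icc 0 k) ∪ Finset.image p (Finset.Icc (k + 1) m) = S := by
      rw [hSi, ← Finset.image_union]
      congr 1
      ext i
      simp only [Finset.mem_union, Finset.mem_Icc, Finset.mem_range]
      omega
    rw [hSS, hS] at D
    exact hno D
  set A := (Finset.range m).filter (fun k => HAdj H a (p (k + 1))) with hA
  set B := (Finset.range m).filter (fun k => HAdj H b (p k)) with hB
  have hAc : (S.filter (fun v => HAdj H a v)).card ≤ A.card := by
    refine (Finset.card_le_card (t := A.image (fun k => p (k + 1))) ?_).trans Finset.card_image_le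
    intro z hz
    rw [Finset.mem_filter, hS1] at hz
    obtain ⟨⟨k, hk, rfl⟩, hz⟩ := hz
    have : k ≠ 0 := by
      rintro rfl; exact hz.1 h0.symm
    have e : k - 1 + 1 = k := by omega
    refine Finset.mem_image.2 ⟨k - 1, ?_, by simp only [e]⟩
    simp only [hA, Finset.mem_filter, Finset.mem_range, e]
    exact ⟨by omega, hz⟩
  have hBc : (S.filter (fun v => HAdj H b v)).card ≤ B.card := by
    refine (Finset.card_le_card (t := B.image p) ?_).trans Finset.card_image_le
    intro z hz
    rw [Finset.mem_filter, hS1] at hz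
    obtain ⟨⟨k, hk, rfl⟩, hz⟩ := hz
    have : k ≠ m := by
      rintro rfl; exact hz.1 h1.symm
    refine Finset.mem_image.2 ⟨k, ?_, rfl⟩
    simp only [hB, Finset.mem_filter, Finset.mem_range]
    exact ⟨by omega, hz⟩
  have d1 := deg_le H S a
  have d2 := deg_le H S b
  have hAB : A.card + B.card ≤ m + (A ∩ B).card := by
    rw [← Finset.card_union_add_card_inter]
    have : A ∪ B ⊆ Finset.range m :=
      Finset.union_subset (Finset.filter_subset _ _) (Finset.filter_subset _ _)
    have := Finset.card_le_card this
    rw [Finset.card_range] at this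
    omega
  set E1 := (Finset.range m).filter (fun k => k + 1 < m ∧ a ∈ g (k + 1))
  set E2 := (Finset.range m).filter (fun k => 1 ≤ k ∧ b ∈ g (k - 1))
  set E3 := (Finset.range m).filter (fun k => p (k + 1) ∈ g 0)
  set E4 := (Finset.range m).filter (fun k => p k ∈ g (m - 1))
  have hsub : A ∩ B ⊆ {0, m - 1} ∪ E1 ∪ E2 ∪ E3 ∪ E4 := by
    intro k hk
    simp only [hA, hB, Finset.mem_inter, Finset.mem_filter, Finset.mem_range] at hk
    have := claim k hk.1.1 hk.1.2 hk.2.2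
    simp only [E1, E2, E3, E4, Finset.mem_union, Finset.mem_filter, Finset.mem_range,
      Finset.mem_insert, Finset.mem_singleton]
    have := hk.1.1
    tauto
  have hc3 : ∀ e ∈ H, e.card ≤ 3 := fun e he => by
    have := h3 e he; omega
  have k3 : E3.card ≤ 3 := by
    refine le_trans ?_ (hc3 (g 0) (hm 0 (by omega)).1)
    refine Finset.card_le_card_of_injOn (fun k => p (k + 1)) ?_ ?_
    · intro k hk
      exact (Finset.mem_filter.1 hk).2
    · intro x hx y hy hxy
      have hx := Finset.mem_range.1 (Finset.mem_filter.1 hx).1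
      have hy := Finset.mem_range.1 (Finset.mem_filter.1 hy).1
      have := hp _ (by omega) _ (by omega) hxy
      omega
  have k4 : E4.card ≤ 3 := by
    refine le_trans ?_ (hc3 (g (m - 1)) (hm (m - 1) (by omega)).1)
    refine Finset.card_le_card_of_injOn p ?_ ?_
    · intro k hk
      exact (Finset.mem_filter.1 hk).2
    · intro x hx y hy hxy
      have hx := Finset.mem_range.1 (Finset.mem_filter.1 hx).1
      have hy := Finset.mem_range.1 (Finset.mem_filter.1 hy).1
      exact hp _ (by omega) _ (by omega) hxy
  have k1 : E1.card ≤ (T.filter (fun e => a ∈ e)).card := by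
    refine Finset.card_le_card_of_injOn (fun k => g (k + 1)) ?_ ?_
    · intro k hk
      have := (Finset.mem_filter.1 hk).2
      exact Finset.mem_filter.2 ⟨(hT1 _).2 ⟨k + 1, this.1, rfl⟩, this.2⟩
    · intro x hx y hy hxy
      have hx := (Finset.mem_filter.1 hx).2.1
      have hy := (Finset.mem_filter.1 hy).2.1
      have := hg _ hx _ hy hxy
      omega
  have k2 : E2.card ≤ (T.filter (fun e => b ∈ e)).card := by
    refine Finset.card_le_card_of_injOn (fun k => g (k - 1)) ?_ ?_
    · intro k hk
      have h1 := (Finset.mem_filter.1 hk).2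
      have h2 := Finset.mem_range.1 (Finset.mem_filter.1 hk).1
      exact Finset.mem_filter.2 ⟨(hT1 _).2 ⟨k - 1, by omega, rfl⟩, h1.2⟩
    · intro x hx y hy hxy
      have hx1 := (Finset.mem_filter.1 hx).2.1
      have hy1 := (Finset.mem_filter.1 hy).2.1
      have hx := Finset.mem_range.1 (Finset.mem_filter.1 hx).1
      have hy := Finset.mem_range.1 (Finset.mem_filter.1 hy).1
      have := hg _ (by omega) _ (by omega) hxy
      omega
  have hfin := Finset.card_le_card hsub
  have u1 := Finset.card_union_le ({0, m - 1} ∪ E1 ∪ E2 ∪ E3) E4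
  have u2 := Finset.card_union_le ({0, m - 1} ∪ E1 ∪ E2) E3
  have u3 := Finset.card_union_le ({0, m - 1} ∪ E1) E2
  have u4 := Finset.card_union_le {0, m - 1} E1
  have u5 := Finset.card_le_two (a := 0) (b := m - 1)
  omega


open Classical in
/-- Number of cycle edges that contain the vertex with index `a`. -/
noncomputable def edgeCount {V : Type*} {H : Finset (Finset V)} {t : ℕ} [NeZero t]
    (C : BergeCycle H t) (a : ZMod t) : ℕ :=
  (Finset.univ.filter (fun k : ZMod t => C.vtx a ∈ C.edge k)).card

theorem pair_count {V : Type*} [Fintype V] {H : Finset (Finset V)} (h3 : IsThreeGraph H) {t : ℕ}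
    [NeZero t] (ht : 3 ≤ t) (hno : ∀ _ : BergeCycle H (t + 1), False)
    (hn : Fintype.card V ≤ t + 2)
    (C : BergeCycle H t) (w : V) (hw : w ∉ Set.range C.vtx) (a1 a2 : ZMod t) (hne : a1 ≠ a2)
    (e e' : Finset V) (he : e ∈ H) (he' : e' ∈ H)
    (hee : e ≠ e') (hwe : w ∈ e) (hwe' : w ∈ e') (h1 : C.vtx (a1 - 1) ∈ e)
    (h1' : C.vtx (a2 - 1) ∈ e') (h2 : e ≠ C.edge (a1 - 2)) (h2' : e' ≠ C.edge (a2 - 2)) :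
    shadowDeg H (C.vtx a1) + shadowDeg H (C.vtx a2) ≤
      t + 14 + edgeCount C a1 + edgeCount C a2 := by
  classical
  have hb : a1 + (((a2 - a1).val : ℕ) : ZMod t) = a2 := by
    rw [ZMod.natCast_zmod_val]; ring
  have hb0 : (a2 - a1).val ≠ 0 := by
    rw [Ne, ZMod.val_eq_zero, sub_eq_zero]; exact fun h => hne h.symm
  obtain ⟨S, T, P, hS, -, hT⟩ := cyc_path h3 ht C w hw a1 (a2 - a1).val 0 (by omega)
    (ZMod.val_lt _) e e' he he' hee hwe hwe' h1 (by rwa [hb]) h2 (by rwa [hb])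
  rw [hb] at P
  simp only [Nat.cast_zero, add_zero] at P
  have key := path_count h3 hno hn P (by omega) (by omega)
  have cnt : ∀ a : ZMod t, (T.filter (fun e => C.vtx a ∈ e)).card ≤ edgeCount C a + 2 := by
    intro a
    have hsub : T.filter (fun e => C.vtx a ∈ e) ⊆ insert e (insert e'
        ((Finset.univ.filter (fun k : ZMod t => C.vtx a ∈ C.edge k)).image C.edge)) := by
      intro f hf
      rw [Finset.mem_filter] at hf
      simp only [Finset.mem_insert, Finset.mem_image, Finset.mem_filter, Finset.mem_univ, true_and]
      rcases hT f hf.1 with h | h | ⟨k, -, h⟩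
      · exact Or.inl h
      · exact Or.inr (Or.inl h)
      · exact Or.inr (Or.inr ⟨_, h ▸ hf.2, h.symm⟩)
    have q := Finset.card_le_card hsub
    have q1 := Finset.card_insert_le e (insert e'
        ((Finset.univ.filter (fun k : ZMod t => C.vtx a ∈ C.edge k)).image C.edge))
    have q2 := Finset.card_insert_le e'
        ((Finset.univ.filter (fun k : ZMod t => C.vtx a ∈ C.edge k)).image C.edge)
    have q3 := Finset.card_image_le (s := Finset.univ.filter (fun k : ZMod t => C.vtx a ∈ C.edge k))
      (f := C.edge)
    unfold edgeCount
    omega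
  have := cnt a1
  have := cnt a2
  omega

theorem edgeCount_sum {V : Type*} {H : Finset (Finset V)} (h3 : IsThreeGraph H) {t : ℕ}
    [NeZero t] (ht : 3 ≤ t) (C : BergeCycle H t) (Q : Finset (ZMod t)) :
    ∑ a ∈ Q, edgeCount C a ≤ t + 2 * Q.card := by
  classical
  have : Fact (1 < t) := ⟨by omega⟩
  set W : ZMod t → Finset (ZMod t) := fun a =>
    Finset.univ.filter (fun k : ZMod t => C.vtx a ∈ C.edge k ∧ k ≠ a ∧ k ≠ a - 1) with hW
  have h1 : ∀ a ∈ Q, edgeCount C a ≤ (W a).card + 2 := by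
    intro a _
    have hsub : (Finset.univ.filter (fun k : ZMod t => C.vtx a ∈ C.edge k)) ⊆
        W a ∪ {a, a - 1} := by
      intro k hk
      simp only [hW, Finset.mem_filter, Finset.mem_union, Finset.mem_univ, true_and,
        Finset.mem_insert, Finset.mem_singleton] at hk ⊢
      tauto
    have q := (Finset.card_le_card hsub).trans (Finset.card_union_le _ _)
    have := Finset.card_le_two (a := a) (b := a - 1)
    unfold edgeCount
    omega
  have h2 := Finset.sum_le_sum h1
  rw [Finset.sum_add_distrib, Finset.sum_const, ← Finset.card_biUnion] at h2
  · have := Finset.card_le_univ (Q.biUnion W)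
    rw [ZMod.card] at this
    simp only [smul_eq_mul] at h2
    omega
  · intro a _ b _ hab
    rw [Function.onFun, Finset.disjoint_left]
    intro k hka hkb
    simp only [hW, Finset.mem_filter, Finset.mem_univ, true_and] at hka hkb
    have v := C.vtx_inj
    rcases card4 h3 (C.edge_mem k) hka.1 hkb.1 (C.mem_fst k) (C.mem_snd k)
      with h | h | h | h | h | h
    · exact hab (v h)
    · exact hka.2.1 (v h).symm
    · exact hka.2.2 (by rw [v h]; ring)
    · exact hkb.2.1 (v h).symm
    · exact hkb.2.2 (by rw [v h]; ring)
    · have := v h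
      simp at this

theorem five_high {V : Type*} [Fintype V] {H : Finset (Finset V)} (h3 : IsThreeGraph H) {t : ℕ}
    [NeZero t] (ht : 3 ≤ t) (hno : ∀ _ : BergeCycle H (t + 1), False)
    (hn : Fintype.card V ≤ t + 2) (hn1 : t + 1 ≤ Fintype.card V)
    (C : BergeCycle H t) (w : V) (hw : w ∉ Set.range C.vtx) (Q : Finset (ZMod t))
    (hQ1 : ∀ a ∈ Q, 3 * Fintype.card V + 180 < 4 * shadowDeg H (C.vtx a))
    (hQ2 : ∀ a ∈ Q, ∃ e ∈ H, e ≠ C.edge (a - 2) ∧ w ∈ e ∧ C.vtx (a - 1) ∈ e) :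
    Q.card ≤ 4 := by
  classical
  by_contra hcon
  choose! c hc using hQ2
  have pick : ∀ R ⊆ Q, 3 ≤ R.card → ∃ a ∈ R, ∃ b ∈ R, a ≠ b ∧ c a ≠ c b := by
    intro R hR h
    obtain ⟨x, hx, y, hy, z, hz, hxy, hxz, hyz⟩ := Finset.two_lt_card.1 h
    by_contra hcon
    push Not at hcon
    have e1 := hcon x hx y hy hxy
    have e2 := hcon x hx z hz hxz
    obtain ⟨p1, p2, p3, p4⟩ := hc x (hR hx)
    obtain ⟨q1, q2, q3, q4⟩ := hc y (hR hy)
    obtain ⟨r1, r2, r3, r4⟩ := hc z (hR hz)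
    rw [← e1] at q4
    rw [← e2] at r4
    have v := C.vtx_inj
    rcases card4 h3 p1 p3 p4 q4 r4 with h | h | h | h | h | h
    · exact hw ⟨_, h.symm⟩
    · exact hw ⟨_, h.symm⟩
    · exact hw ⟨_, h.symm⟩
    · exact hxy (sub_left_injective (v h))
    · exact hxz (sub_left_injective (v h))
    · exact hyz (sub_left_injective (v h))
  obtain ⟨a1, ha1, a2, ha2, hne, hcne⟩ := pick Q subset_rfl (by omega)
  have hcard : 3 ≤ (Q \ {a1, a2}).card := by
    have := Finset.le_card_sdiff {a1, a2} Q
    have := Finset.card_le_two (a := a1) (b := a2)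
    omega
  obtain ⟨a3, ha3, a4, ha4, hne', hcne'⟩ := pick _ Finset.sdiff_subset hcard
  simp only [Finset.mem_sdiff, Finset.mem_insert, Finset.mem_singleton, not_or] at ha3 ha4
  have k1 := hc a1 ha1
  have k2 := hc a2 ha2
  have k3 := hc a3 ha3.1
  have k4 := hc a4 ha4.1
  have r1 := pair_count h3 ht hno hn C w hw a1 a2 hne (c a1) (c a2) k1.1 k2.1 hcne
    k1.2.2.1 k2.2.2.1 k1.2.2.2 k2.2.2.2 k1.2.1 k2.2.1
  have r2 := pair_count h3 ht hno hn C w hw a3 a4 hne' (c a3) (c a4) k3.1 k4.1 hcne'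
    k3.2.2.1 k4.2.2.1 k3.2.2.2 k4.2.2.2 k3.2.1 k4.2.1
  have hs := edgeCount_sum h3 ht C {a1, a2, a3, a4}
  rw [Finset.sum_insert, Finset.sum_insert, Finset.sum_insert, Finset.sum_singleton] at hs
  · have c4 := Finset.card_le_four (a := a1) (b := a2) (c := a3) (d := a4)
    have := hQ1 a1 ha1
    have := hQ1 a2 ha2
    have := hQ1 a3 ha3.1
    have := hQ1 a4 ha4.1
    omega
  · simpa using hne'
  · simp only [Finset.mem_insert, Finset.mem_singleton, not_or]
    exact ⟨fun h => ha3.2.2 h.symm, fun h => ha4.2.2 h.symm⟩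
  · simp only [Finset.mem_insert, Finset.mem_singleton, not_or]
    exact ⟨hne, fun h => ha3.2.1 h.symm, fun h => ha4.2.1 h.symm⟩

/-- The reversed cycle. -/
def BergeCycle.flip {V : Type*} {H : Finset (Finset V)} {t : ℕ} (C : BergeCycle H t) :
    BergeCycle H t where
  vtx k := C.vtx (-k)
  edge k := C.edge (-k - 1)
  vtx_inj := fun a b h => neg_injective (C.vtx_inj h)
  edge_inj := fun a b h => neg_injective (sub_left_injective (C.edge_inj h))
  edge_mem := fun _ => C.edge_mem _
  mem_fst := fun i => by
    have := C.mem_snd (-i - 1)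
    rwa [sub_add_cancel] at this
  mem_snd := fun i => by
    have := C.mem_fst (-i - 1)
    have e : -(i + 1) = -i - 1 := by ring
    rwa [e]

theorem step2 {V : Type*} [Fintype V] {H : Finset (Finset V)} (h3 : IsThreeGraph H) {t : ℕ}
    [NeZero t] (ht : 3 ≤ t) (hno : ∀ _ : BergeCycle H (t + 1), False)
    (hn : Fintype.card V ≤ t + 2) (hn1 : t + 1 ≤ Fintype.card V) (hbig : 189 ≤ Fintype.card V)
    (hOre : ∀ u v : V, u ≠ v → ¬ HAdj H u v →
      Fintype.card V + 65 ≤ shadowDeg H u + shadowDeg H v)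
    (C : BergeCycle H t) (w : V) (hw : w ∉ Set.range C.vtx)
    (hdw : Fintype.card V + 59 ≤ 2 * shadowDeg H w) (x : V)
    (hx : 4 * shadowDeg H x < Fintype.card V + 80) : False := by
  classical
  have : Fact (1 < t) := ⟨by omega⟩
  set N := Finset.univ.filter (fun m : ZMod t => HAdj H w (C.vtx m)) with hN
  set F := Finset.univ.filter (fun m : ZMod t => ∃ e ∈ H, e ≠ C.edge m ∧ e ≠ C.edge (m - 1) ∧
    w ∈ e ∧ C.vtx m ∈ e) with hF
  set M := Finset.univ.filter (fun m : ZMod t => w ∈ C.edge m) with hM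
  set M1 := M.image (fun m => m + 1) with hM1
  set L := Finset.univ.filter (fun m : ZMod t => C.vtx m = x ∨ HAdj H x (C.vtx m)) with hL
  set Qp := Finset.univ.filter (fun a : ZMod t => (a - 1 ∈ F ∨ a - 1 ∈ M) ∧ a ∉ L) with hQp
  set Qm := Finset.univ.filter (fun a : ZMod t => (a + 1 ∈ F ∨ a ∈ M) ∧ a ∉ L) with hQm
  have high : ∀ a, a ∉ L → 3 * Fintype.card V + 180 < 4 * shadowDeg H (C.vtx a) := by
    intro a ha
    simp only [hL, Finset.mem_filter, Finset.mem_univ, true_and, not_or] at ha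
    have := hOre x (C.vtx a) (fun h => ha.1 h.symm) ha.2
    omega
  have hNc : shadowDeg H w ≤ N.card + 1 := by
    have d := deg_le H (insert w (Finset.univ.image C.vtx)) w
    rw [Finset.card_insert_of_notMem (by simpa using hw),
      Finset.card_image_of_injective _ C.vtx_inj, Finset.card_univ, ZMod.card] at d
    have : ((insert w (Finset.univ.image C.vtx)).filter (fun v => HAdj H w v)).card ≤ N.card := by
      refine (Finset.card_le_card (t := N.image C.vtx) ?_).trans Finset.card_image_le
      intro z hz
      simp only [Finset.mem_filter, Finset.mem_insert, Finset.mem_image, Finset.mem_univ,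
        true_and] at hz
      obtain ⟨rfl | ⟨k, rfl⟩, hz⟩ := hz
      · exact absurd rfl hz.1
      · exact Finset.mem_image.2 ⟨k, by simpa [hN] using hz, rfl⟩
    omega
  have hLc : L.card ≤ shadowDeg H x + 1 := by
    have hsub : L.image C.vtx ⊆ insert x (Finset.univ.filter (fun v => HAdj H x v)) := by
      intro z hz
      obtain ⟨k, hk, rfl⟩ := Finset.mem_image.1 hz
      simpa [hL] using hk
    have q := (Finset.card_le_card hsub).trans (Finset.card_insert_le _ _)
    rw [Finset.card_image_of_injective _ C.vtx_inj] at q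
    have h1 : {v | HAdj H x v} =
        ((Finset.univ.filter (fun v => HAdj H x v) : Finset V) : Set V) := by
      ext; simp
    unfold shadowDeg
    rw [h1, Set.ncard_coe_finset]
    exact q
  have hQpc : Qp.card ≤ 4 := by
    apply five_high h3 ht hno hn hn1 C w hw
    · intro a ha
      exact high a (Finset.mem_filter.1 ha).2.2
    · intro a ha
      have ha := (Finset.mem_filter.1 ha).2.1
      have e1 : a - 1 - 1 = a - 2 := by ring
      rcases ha with ha | ha
      · obtain ⟨e, he, q1, q2, q3, q4⟩ := (Finset.mem_filter.1 ha).2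
        rw [e1] at q2
        exact ⟨e, he, q2, q3, q4⟩
      · refine ⟨C.edge (a - 1), C.edge_mem _, ?_, (Finset.mem_filter.1 ha).2, C.mem_fst _⟩
        intro h
        have := C.edge_inj h
        rw [← e1] at this
        exact one_ne_zero (sub_eq_self.1 this.symm)
  have hQmc : Qm.card ≤ 4 := by
    rw [← Finset.card_image_of_injective Qm neg_injective]
    apply five_high h3 ht hno hn hn1 C.flip w
    · rintro ⟨k, hk⟩
      exact hw ⟨-k, hk⟩
    · intro a ha
      obtain ⟨b, hb, rfl⟩ := Finset.mem_image.1 ha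
      have := high b (Finset.mem_filter.1 hb).2.2
      simpa [BergeCycle.flip] using this
    · intro a' ha'
      obtain ⟨a, ha, rfl⟩ := Finset.mem_image.1 ha'
      have ha := (Finset.mem_filter.1 ha).2.1
      have e1 : C.flip.edge (-a - 2) = C.edge (a + 1) := by
        simp only [BergeCycle.flip]; congr 1; ring
      have e2 : C.flip.vtx (-a - 1) = C.vtx (a + 1) := by
        simp only [BergeCycle.flip]; congr 1; ring
      rw [e1, e2]
      rcases ha with ha | ha
      · obtain ⟨e, he, q1, q2, q3, q4⟩ := (Finset.mem_filter.1 ha).2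
        exact ⟨e, he, q1, q3, q4⟩
      · refine ⟨C.edge a, C.edge_mem _, ?_, (Finset.mem_filter.1 ha).2, C.mem_snd _⟩
        intro h
        have := C.edge_inj h
        simp at this
  have hNsub : ∀ m ∈ N, m ∈ F ∨ m ∈ M ∨ m ∈ M1 := by
    intro m hm
    obtain ⟨-, e, he, q1, q2⟩ := (Finset.mem_filter.1 hm).2
    by_cases c1 : e = C.edge m
    · right; left
      simp only [hM, Finset.mem_filter, Finset.mem_univ, true_and]
      rwa [← c1]
    by_cases c2 : e = C.edge (m - 1)
    · right; right
      refine Finset.mem_image.2 ⟨m - 1, ?_, by ring⟩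
      simp only [hM, Finset.mem_filter, Finset.mem_univ, true_and]
      rwa [← c2]
    · left
      simp only [hF, Finset.mem_filter, Finset.mem_univ, true_and]
      exact ⟨e, he, c1, c2, q1, q2⟩
  have i1 : (F ∪ M).card ≤ Qp.card + L.card := by
    rw [← Finset.card_image_of_injective (F ∪ M) (add_left_injective (1 : ZMod t))]
    refine (Finset.card_le_card ?_).trans (Finset.card_union_le Qp L)
    intro z hz
    obtain ⟨k, hk, rfl⟩ := Finset.mem_image.1 hz
    rw [Finset.mem_union] at hk
    by_cases hl : k + 1 ∈ L
    · exact Finset.mem_union_right _ hl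
    · refine Finset.mem_union_left _ (Finset.mem_filter.2 ⟨Finset.mem_univ _, ?_, hl⟩)
      simpa using hk
  have i2 : (M ∪ M1).card ≤ Qp.card + Qm.card + L.card := by
    have q : M ∪ M1 ⊆ Qp ∪ Qm ∪ L := by
      intro z hz
      by_cases hl : z ∈ L
      · exact Finset.mem_union_right _ hl
      apply Finset.mem_union_left
      rcases Finset.mem_union.1 hz with h | h
      · exact Finset.mem_union_right _ (Finset.mem_filter.2 ⟨Finset.mem_univ _, Or.inr h, hl⟩)
      · refine Finset.mem_union_left _ (Finset.mem_filter.2 ⟨Finset.mem_univ _, Or.inr ?_, hl⟩)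
        obtain ⟨k, hk, rfl⟩ := Finset.mem_image.1 h
        simpa using hk
    have := Finset.card_le_card q
    have := Finset.card_union_le (Qp ∪ Qm) L
    have := Finset.card_union_le Qp Qm
    omega
  have i3 : N.card ≤ (F \ (M ∪ M1)).card + (M ∪ M1).card := by
    refine (Finset.card_le_card ?_).trans (Finset.card_union_le _ _)
    intro z hz
    have := hNsub z hz
    simp only [Finset.mem_union, Finset.mem_sdiff]
    tauto
  have i4 : (F \ (M ∪ M1)).card + M.card ≤ (F ∪ M).card := by
    rw [← Finset.card_union_of_disjoint]
    · apply Finset.card_le_card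
      intro z hz
      simp only [Finset.mem_union, Finset.mem_sdiff] at hz ⊢
      tauto
    · rw [Finset.disjoint_left]
      intro z hz hz'
      simp only [Finset.mem_union, Finset.mem_sdiff] at hz
      tauto
  have i5 : N.card ≤ (F ∪ M).card + M1.card := by
    refine (Finset.card_le_card ?_).trans (Finset.card_union_le _ _)
    intro z hz
    have := hNsub z hz
    simp only [Finset.mem_union]
    tauto
  have i6 : M1.card ≤ M.card := Finset.card_image_le
  omega


theorem step1 {V : Type*} {H : Finset (Finset V)} (h3 : IsThreeGraph H) {t : ℕ}
    [NeZero t] (ht : 3 ≤ t) (C : BergeCycle H t) (u : V) (hu : u ∉ Set.range C.vtx)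
    (U : Set (ZMod t)) (hU : Usable C u U) (i a : ZMod t) (hi : i ∈ U) (ha : a ∈ U)
    (hia : i ≠ a) (hia2 : a ≠ i + 2) (hadj : HAdj H (C.vtx (i + 1)) (C.vtx a))
    (hn1 : C.vtx a ∉ C.edge (i + 1)) (hn2 : C.vtx (i + 1) ∉ C.edge a) :
    ∃ C' : BergeCycle H t, C.vtx i ∉ Set.range C'.vtx := by
  have : Fact (1 < t) := ⟨by omega⟩
  obtain ⟨e, he, e', he', hee, q1, q2, q3, q4, q5, q6⟩ := hU.2.2 i hi a ha hia
  obtain ⟨m1, m2⟩ := hU.2.1 i hi a ha hia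
  have hb : i + (((a - i).val : ℕ) : ZMod t) = a := by
    rw [ZMod.natCast_zmod_val]; ring
  have hb0 : (a - i).val ≠ 0 := by
    rw [Ne, ZMod.val_eq_zero, sub_eq_zero]; exact fun h => hia h.symm
  have hb1 : (a - i).val ≠ 1 := by
    intro h
    rw [h] at hb
    exact m1 (by rw [← hb]; simp)
  have hbt : (a - i).val < t := ZMod.val_lt _
  have v := C.vtx_inj
  obtain ⟨S, T, P, hS, hSi, hT⟩ := cyc_path h3 ht C u hu i (a - i).val 1 (by omega)
    hbt e e' he he' hee q2 q5 q3 (by rwa [hb]) q1 (by rwa [hb])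
  have h2 : (i : ZMod t) - 1 ≠ i + 1 := by
    intro h
    have h' : i + ((t - 1 : ℕ) : ZMod t) = i + ((1 : ℕ) : ZMod t) := by
      rw [cast_pred 1 (by omega), Nat.cast_one, ← h]; ring
    have := zmod_win i _ _ (by omega) (by omega) h'
    omega
  rw [hb, Nat.cast_one] at P
  obtain ⟨-, f, hf, f1, f2⟩ := hadj
  have hfT : f ∉ T := by
    intro hfT
    rcases hT f hfT with rfl | rfl | ⟨k, hk, rfl⟩
    · rcases card4 h3 hf q2 q3 f1 f2 with h | h | h | h | h | h
      · exact hu ⟨_, h.symm⟩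
      · exact hu ⟨_, h.symm⟩
      · exact hu ⟨_, h.symm⟩
      · exact h2 (v h)
      · exact m2 (v h).symm
      · exact m1 (v h).symm
    · rcases card4 h3 hf q5 q6 f1 f2 with h | h | h | h | h | h
      · exact hu ⟨_, h.symm⟩
      · exact hu ⟨_, h.symm⟩
      · exact hu ⟨_, h.symm⟩
      · apply hia2
        have := v h
        linear_combination this
      · have := v h
        exact one_ne_zero (sub_eq_self.1 this)
      · exact m1 (v h).symm
    · have g1 := C.mem_fst (i + (k : ℕ))
      have g2 := C.mem_snd (i + (k : ℕ))
      have e2 : i + ((k : ℕ) : ZMod t) + 1 = i + ((k + 1 : ℕ) : ZMod t) := by push_cast; ring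
      have e3 : i + 1 = i + ((1 : ℕ) : ZMod t) := by push_cast; ring
      rw [e2] at g2
      have hka : k = (a - i).val → False := by
        intro h
        rw [h, hb] at f1
        exact hn2 f1
      have hk1 : k = 1 → False := by
        intro h
        rw [h, ← e3] at f2
        exact hn1 f2
      rcases card4 h3 hf f1 f2 g1 g2 with h | h | h | h | h | h
      · exact m1 (v h).symm
      · have h := v h
        rw [e3] at h
        exact hk1 (zmod_win i _ _ (by omega) (by omega) h).symm
      · have h := v h
        rw [e3] at h
        have := zmod_win i _ _ (by omega) (by omega) h
        omega
      · have h := v h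
        rw [← hb] at h
        exact hka (zmod_win i _ _ (by omega) (by omega) h).symm
      · have h := v h
        rw [← hb] at h
        have := zmod_win i _ _ (by omega) (by omega) h
        omega
      · have := zmod_win i _ _ (by omega) (by omega) (v h)
        omega
  have hC := P.close f hf hfT f1 f2
  have hSt : S.card = t := by omega
  rw [hSt] at hC
  obtain ⟨D, hD⟩ := hC
  refine ⟨D, ?_⟩
  rw [hD]
  have := hSi 0 (by omega)
  simpa using this

theorem min_deg {V : Type*} [Fintype V] (H : Finset (Finset V)) (hn : 69 ≤ Fintype.card V)
    (hOre : ∀ u v : V, u ≠ v → ¬ HAdj H u v →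
      Fintype.card V + 65 ≤ shadowDeg H u + shadowDeg H v) (z : V) : 67 ≤ shadowDeg H z := by
  classical
  by_cases h : ∃ y, z ≠ y ∧ ¬ HAdj H z y
  · obtain ⟨y, hy, hzy⟩ := h
    have h1 := hOre z y hy hzy
    have h2 : shadowDeg H y ≤ Fintype.card V - 2 := by
      have hsub : {v | HAdj H y v} ⊆ (((Finset.univ \ {y, z} : Finset V)) : Set V) := by
        intro v hv
        simp only [Finset.coe_sdiff, Finset.coe_univ, Finset.coe_insert, Finset.coe_singleton,
          Set.mem_diff, Set.mem_univ, true_and, Set.mem_insert_iff, Set.mem_singleton_iff, not_or]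
        refine ⟨fun h => hv.1 h.symm, ?_⟩
        rintro rfl
        exact hzy hv.symm'
      have := Set.ncard_le_ncard hsub (Finset.finite_toSet _)
      rw [Set.ncard_coe_finset, Finset.card_sdiff_of_subset (Finset.subset_univ _),
        Finset.card_pair hy.symm, Finset.card_univ] at this
      exact this
    omega
  · push Not at h
    have hsub : ((({z}ᶜ : Finset V)) : Set V) ⊆ {v | HAdj H z v} := by
      intro v hv
      simp at hv
      exact h v (fun h => hv h.symm)
    have := Set.ncard_le_ncard hsub (Set.toFinite _)
    rw [Set.ncard_coe_finset, Finset.card_compl, Finset.card_singleton] at this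
    unfold shadowDeg
    omega

theorem dC_le {V : Type*} [Fintype V] {H : Finset (Finset V)} {t : ℕ} (C : BergeCycle H t)
    (z : V) : C.dC z ≤ shadowDeg H z :=
  Set.ncard_le_ncard (fun _ h => h.2) (Set.toFinite _)

theorem le_dC {V : Type*} [Fintype V] {H : Finset (Finset V)} {t : ℕ} [NeZero t]
    (C : BergeCycle H t) (z : V) : shadowDeg H z + t ≤ C.dC z + Fintype.card V := by
  classical
  have d := deg_le H (Finset.univ.image C.vtx) z
  rw [Finset.card_image_of_injective _ C.vtx_inj, Finset.card_univ, ZMod.card] at d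
  have : C.dC z = ((Finset.univ.image C.vtx).filter (fun v => HAdj H z v)).card := by
    rw [BergeCycle.dC, ← Set.ncard_coe_finset]
    congr 1
    ext v
    simp
  omega

theorem le_dC' {V : Type*} [Fintype V] {H : Finset (Finset V)} {t : ℕ} [NeZero t]
    (C : BergeCycle H t) (z : V) (hz : z ∉ Set.range C.vtx) :
    shadowDeg H z + t + 1 ≤ C.dC z + Fintype.card V := by
  classical
  have d := deg_le H (insert z (Finset.univ.image C.vtx)) z
  rw [Finset.card_insert_of_notMem (by simpa using hz),
    Finset.card_image_of_injective _ C.vtx_inj, Finset.card_univ, ZMod.card] at d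
  have : C.dC z = ((insert z (Finset.univ.image C.vtx)).filter (fun v => HAdj H z v)).card := by
    rw [BergeCycle.dC, ← Set.ncard_coe_finset]
    congr 1
    ext v
    have : ¬ HAdj H z z := fun h => h.1 rfl
    simp only [Set.mem_setOf_eq, Finset.coe_filter, Finset.mem_insert, Finset.mem_image,
      Finset.mem_univ, true_and, Set.mem_range]
    constructor
    · rintro ⟨h1, h2⟩
      exact ⟨Or.inr h1, h2⟩
    · rintro ⟨rfl | h1, h2⟩
      · exact absurd h2 this
      · exact ⟨h1, h2⟩
  omega


/-- Claim 9: at most one vertex of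
`X = {v_{i+1} : v_i ∈ U_u ∩ B₁(C)}` lies in `S'(C) = {v : d_C(v) < n/4 + 18}`. -/
theorem stmt17 {V : Type*} [Fintype V] (n : ℕ) (hn : 69 ≤ n)
    (hcard : Fintype.card V = n) (H : Finset (Finset V)) (h3 : IsThreeGraph H)
    (hOre : ∀ u v : V, u ≠ v → ¬ HAdj H u v →
      n + 65 ≤ shadowDeg H u + shadowDeg H v)
    (hnoham : ¬ HamiltonianBergeCycle H)
    {t : ℕ} (C : BergeCycle H t)
    (hlong : ∀ (t' : ℕ) (C' : BergeCycle H t'), t' ≤ t)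
    (ht : t = n - 1 ∨ t = n - 2)
    (u : V) (hu : u ∉ Set.range C.vtx)
    (U : Set (ZMod t)) (hU : Usable C u U) (hUcard : (C.dC u : ℚ) / 6 ≤ U.ncard) :
    {i ∈ U | ((n + 65 : ℚ) / 2 - 3 ≤ (C.dC (C.vtx i) : ℚ) ∧
        (C.dC (C.vtx i) : ℚ) < 3 * (n : ℚ) / 4 + 13) ∧
      (C.dC (C.vtx (i + 1)) : ℚ) < (n : ℚ) / 4 + 18}.ncard ≤ 1 := by

  classical
  subst hcard
  have hno : ∀ _ : BergeCycle H (t + 1), False := fun D => by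
    have := hlong _ D
    omega
  have hnt : Fintype.card V ≤ t + 2 := by omega
  have hnt1 : t + 1 ≤ Fintype.card V := by omega
  have ht3 : 3 ≤ t := by omega
  have : NeZero t := ⟨by omega⟩
  have : Fact (1 < t) := ⟨by omega⟩
  have v := C.vtx_inj
  by_contra hcon
  push Not at hcon
  obtain ⟨i, hi, j, hj, hij⟩ := (Set.one_lt_ncard (Set.toFinite _)).1 hcon
  obtain ⟨hiU, ⟨hi1, -⟩, hi2⟩ := hi
  obtain ⟨hjU, ⟨hj1, -⟩, hj2⟩ := hj
  have low : ∀ k : ZMod t, (C.dC (C.vtx (k + 1)) : ℚ) < (Fintype.card V : ℚ) / 4 + 18 →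
      4 * shadowDeg H (C.vtx (k + 1)) < Fintype.card V + 80 := by
    intro k hk
    have h1 := le_dC C (C.vtx (k + 1))
    have h2 : (4 * C.dC (C.vtx (k + 1)) : ℚ) < (Fintype.card V : ℚ) + 72 := by linarith
    have h3 : 4 * C.dC (C.vtx (k + 1)) < Fintype.card V + 72 := by exact_mod_cast h2
    omega
  have mid : ∀ k : ZMod t, ((Fintype.card V + 65 : ℚ) / 2 - 3 ≤ (C.dC (C.vtx k) : ℚ)) →
      Fintype.card V + 59 ≤ 2 * shadowDeg H (C.vtx k) := by
    intro k hk
    have h1 := dC_le C (C.vtx k)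
    have h2 : (Fintype.card V : ℚ) + 59 ≤ 2 * C.dC (C.vtx k) := by linarith
    have h3 : Fintype.card V + 59 ≤ 2 * C.dC (C.vtx k) := by exact_mod_cast h2
    omega
  have lowi := low i hi2
  have lowj := low j hj2
  have midi := mid i hi1
  have midj := mid j hj1
  have hbig : 189 ≤ Fintype.card V := by
    have := min_deg H hn hOre (C.vtx (i + 1))
    omega
  have hUc : 11 ≤ U.ncard := by
    have h1 := min_deg H hn hOre u
    have h2 := le_dC' C u hu
    have h3 : (66 : ℚ) ≤ C.dC u := by
      have : 66 ≤ C.dC u := by omega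
      exact_mod_cast this
    have h4 : (11 : ℚ) ≤ U.ncard := by linarith
    exact_mod_cast h4
  set Q := U.toFinset with hQ
  have hQc : 11 ≤ Q.card := by rwa [← Set.ncard_eq_toFinset_card']
  have hQU : ∀ a, a ∈ Q ↔ a ∈ U := fun a => Set.mem_toFinset
  have hsucc : ∀ a ∈ U, ∀ k ∈ U, a ≠ k + 1 := by
    intro a ha k hk h
    by_cases hka : k = a
    · subst hka
      simp at h
    · exact (hU.2.1 k hk a ha hka).1 h
  have hlowcount : (Q.filter (fun a => ¬ (HAdj H (C.vtx (i + 1)) (C.vtx a) ∧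
      HAdj H (C.vtx (j + 1)) (C.vtx a)))).card ≤ 4 := by
    apply five_high h3 ht3 hno hnt hnt1 C u hu
    · intro a ha
      rw [Finset.mem_filter, hQU] at ha
      obtain ⟨haU, ha⟩ := ha
      by_cases h : HAdj H (C.vtx (i + 1)) (C.vtx a)
      · have h' : ¬ HAdj H (C.vtx (j + 1)) (C.vtx a) := fun h' => ha ⟨h, h'⟩
        have := hOre _ _ (fun q => hsucc a haU j hjU (v q).symm) h'
        omega
      · have := hOre _ _ (fun q => hsucc a haU i hiU (v q).symm) h
        omega
    · intro a ha
      rw [Finset.mem_filter, hQU] at ha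
      exact hU.1 a ha.1
  set R := Q.filter (fun a => HAdj H (C.vtx (i + 1)) (C.vtx a) ∧
      HAdj H (C.vtx (j + 1)) (C.vtx a)) with hR
  have hRc : 7 ≤ R.card := by
    have hsub : Q ⊆ R ∪ Q.filter (fun a => ¬ (HAdj H (C.vtx (i + 1)) (C.vtx a) ∧
        HAdj H (C.vtx (j + 1)) (C.vtx a))) := by
      intro a ha
      by_cases h : HAdj H (C.vtx (i + 1)) (C.vtx a) ∧ HAdj H (C.vtx (j + 1)) (C.vtx a)
      · exact Finset.mem_union_left _ (Finset.mem_filter.2 ⟨ha, h⟩)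
      · exact Finset.mem_union_right _ (Finset.mem_filter.2 ⟨ha, h⟩)
    have := (Finset.card_le_card hsub).trans (Finset.card_union_le _ _)
    omega
  have hR'c : 3 ≤ (R \ {i, j, i + 2, j + 2}).card := by
    have := Finset.le_card_sdiff {i, j, i + 2, j + 2} R
    have := Finset.card_le_four (a := i) (b := j) (c := i + 2) (d := j + 2)
    omega
  have block : ∀ k a : ZMod t, k ∈ U → a ∈ U → k ≠ a → a ≠ k + 2 →
      HAdj H (C.vtx (k + 1)) (C.vtx a) → 4 * shadowDeg H (C.vtx (k + 1)) < Fintype.card V + 80 →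
      Fintype.card V + 59 ≤ 2 * shadowDeg H (C.vtx k) →
      C.vtx a ∈ C.edge (k + 1) ∨ C.vtx (k + 1) ∈ C.edge a := by
    intro k a hk ha hka hka2 hadj hlow hmid
    by_contra hcon
    push Not at hcon
    obtain ⟨D, hD⟩ := step1 h3 ht3 C u hu U hU k a hk ha hka hka2 hadj hcon.1 hcon.2
    exact step2 h3 ht3 hno hnt hnt1 hbig hOre D _ hD hmid _ hlow
  have hmem : ∀ a ∈ R \ {i, j, i + 2, j + 2}, (a ∈ U ∧ a ≠ i ∧ a ≠ j ∧ a ≠ i + 2 ∧ a ≠ j + 2) ∧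
      (C.vtx a ∈ C.edge (i + 1) ∨ C.vtx a ∈ C.edge (j + 1)) := by
    intro a ha
    simp only [hR, Finset.mem_sdiff, Finset.mem_filter, hQU, Finset.mem_insert,
      Finset.mem_singleton, not_or] at ha
    obtain ⟨⟨haU, ad1, ad2⟩, n1, n2, n3, n4⟩ := ha
    refine ⟨⟨haU, n1, n2, n3, n4⟩, ?_⟩
    rcases block i a hiU haU (Ne.symm n1) n3 ad1 lowi midi with b1 | b1
    · exact Or.inl b1
    rcases block j a hjU haU (Ne.symm n2) n4 ad2 lowj midj with b2 | b2
    · exact Or.inr b2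
    exfalso
    rcases card4 h3 (C.edge_mem a) (C.mem_fst a) (C.mem_snd a) b1 b2 with h | h | h | h | h | h
    · have := v h
      simp at this
    · exact hsucc a haU i hiU (v h)
    · exact hsucc a haU j hjU (v h)
    · exact n1 (add_right_cancel (v h))
    · exact n2 (add_right_cancel (v h))
    · exact hij (add_right_cancel (v h))
  have uniq : ∀ k a b : ZMod t, k ∈ U → a ∈ U → b ∈ U → a ≠ k + 2 → b ≠ k + 2 →
      C.vtx a ∈ C.edge (k + 1) → C.vtx b ∈ C.edge (k + 1) → a = b := by
    intro k a b hk ha hb ha2 hb2 h1 h2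
    have e2 : k + 1 + 1 = k + 2 := by ring
    rcases card4 h3 (C.edge_mem (k + 1)) h1 h2 (C.mem_fst _) (C.mem_snd _)
      with h | h | h | h | h | h
    · exact v h
    · exact absurd (v h) (hsucc a ha k hk)
    · exact absurd ((v h).trans e2) ha2
    · exact absurd (v h) (hsucc b hb k hk)
    · exact absurd ((v h).trans e2) hb2
    · have := v h
      simp at this
  obtain ⟨x, hx, y, hy, z, hz, hxy, hxz, hyz⟩ := Finset.two_lt_card.1 hR'c
  obtain ⟨⟨x1, -, -, x2, x3⟩, hx⟩ := hmem x hx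
  obtain ⟨⟨y1, -, -, y2, y3⟩, hy⟩ := hmem y hy
  obtain ⟨⟨z1, -, -, z2, z3⟩, hz⟩ := hmem z hz
  rcases hx with hx | hx <;> rcases hy with hy | hy <;> rcases hz with hz | hz
  · exact hxy (uniq i x y hiU x1 y1 x2 y2 hx hy)
  · exact hxy (uniq i x y hiU x1 y1 x2 y2 hx hy)
  · exact hxz (uniq i x z hiU x1 z1 x2 z2 hx hz)
  · exact hyz (uniq j y z hjU y1 z1 y3 z3 hy hz)
  · exact hyz (uniq i y z hiU y1 z1 y2 z2 hy hz)
  · exact hxz (uniq j x z hjU x1 z1 x3 z3 hx hz)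
  · exact hxy (uniq j x y hjU x1 y1 x3 y3 hx hy)
  · exact hxy (uniq j x y hjU x1 y1 x3 y3 hx hy)
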